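/- Let f : ℝ^d → ℝ be μ-strongly convex and L-smooth. Let x, y : [0,∞) → ℝ^d be twice differentiable curves satisfying x''(t) = -∇f(x(t)) and y''(t) = -∇f(y(t)) with x'(0) = y'(0). Define α(t) = (1/2)‖x(t) - y(t)‖². Then for every t with 0 ≤ t ≤ 1/(2√L), one has α'(t) ≤ -α(0)·(μ/2)·t. -/

import Mathlib

open Real
open scoped InnerProductSpace

section SmoothConvex

variable {E : Type*} [NormedAddCommGroup E] [InnerProductSpace ℝ E] [CompleteSpace E]

/-- The descent lemma for a function with `L`-Lipschitz gradient. -/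
theorem le_add_inner_gradient_add_sq {f : E → ℝ} {L : ℝ} (hf : Differentiable ℝ f)
    (hsmooth : ∀ a b, ‖gradient f a - gradient f b‖ ≤ L * ‖a - b‖) (a b : E) :
    f b ≤ f a + ⟪gradient f a, b - a⟫_ℝ + L / 2 * ‖b - a‖ ^ 2 := by
  set h := b - a with hh
  have hline (s : ℝ) : HasDerivAt (fun s : ℝ => a + s • h) h s := by
    simpa using ((hasDerivAt_id s).smul_const h).const_add a
  have hφ (s : ℝ) : HasDerivAt
      (fun s : ℝ => f (a + s • h) - s * ⟪gradient f a, h⟫_ℝ - L / 2 * ‖h‖ ^ 2 * s ^ 2)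
      (⟪gradient f (a + s • h), h⟫_ℝ - ⟪gradient f a, h⟫_ℝ - L * ‖h‖ ^ 2 * s) s := by
    have h1 := (hf (a + s • h)).hasGradientAt.hasFDerivAt.comp_hasDerivAt s (hline s)
    have h2 := (hasDerivAt_id s).mul_const ⟪gradient f a, h⟫_ℝ
    have h3 := ((hasDerivAt_id s).pow 2).const_mul (L / 2 * ‖h‖ ^ 2)
    refine ((h1.sub h2).sub h3).congr_deriv ?_
    simp
    ring
  have hanti := antitoneOn_of_hasDerivWithinAt_nonpos (convex_Icc (0 : ℝ) 1)
    (fun s _ => (hφ s).continuousAt.continuousWithinAt)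
    (fun s _ => (hφ s).hasDerivWithinAt) (by
      intro s hs
      rw [interior_Icc] at hs
      have h1 := hsmooth (a + s • h) a
      rw [add_sub_cancel_left, norm_smul, Real.norm_of_nonneg hs.1.le] at h1
      have h2 := real_inner_le_norm (gradient f (a + s • h) - gradient f a) h
      rw [inner_sub_left] at h2
      nlinarith [mul_le_mul_of_nonneg_right h1 (norm_nonneg h)])
  have := hanti (Set.left_mem_Icc.2 zero_le_one) (Set.right_mem_Icc.2 zero_le_one) zero_le_one
  have hab : a + h = b := by simp [hh]
  simp only [one_smul, zero_smul, add_zero, hab] at this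
  linarith

/-- The gradient of a convex function with `L`-Lipschitz gradient is `1/L`-cocoercive. -/
theorem norm_gradient_sub_sq_le_inner {f : E → ℝ} {L : ℝ} (hL : 0 < L) (hf : Differentiable ℝ f)
    (hconvex : ∀ a b, f a + ⟪gradient f a, b - a⟫_ℝ ≤ f b)
    (hsmooth : ∀ a b, ‖gradient f a - gradient f b‖ ≤ L * ‖a - b‖) (a b : E) :
    ‖gradient f a - gradient f b‖ ^ 2 ≤ L * ⟪a - b, gradient f a - gradient f b⟫_ℝ := by
  have key (a b : E) : f a + ⟪gradient f a, b - a⟫_ℝ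
      + L⁻¹ / 2 * ‖gradient f a - gradient f b‖ ^ 2 ≤ f b := by
    set w := gradient f a - gradient f b with hw
    have h1 := hconvex a (b + L⁻¹ • w)
    have h2 := le_add_inner_gradient_add_sq hf hsmooth b (b + L⁻¹ • w)
    have h3 : ⟪gradient f a, w⟫_ℝ - ⟪gradient f b, w⟫_ℝ = ‖w‖ ^ 2 := by
      rw [← inner_sub_left, ← hw, real_inner_self_eq_norm_sq]
    rw [add_sub_right_comm, inner_add_right, inner_smul_right] at h1
    rw [add_sub_cancel_left, inner_smul_right, norm_smul, Real.norm_of_nonneg (by positivity)] at h2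
    have h4 : L / 2 * (L⁻¹ * ‖w‖) ^ 2 = L⁻¹ / 2 * ‖w‖ ^ 2 := by field_simp
    have h5 : L⁻¹ * ⟪gradient f a, w⟫_ℝ - L⁻¹ * ⟪gradient f b, w⟫_ℝ = L⁻¹ * ‖w‖ ^ 2 := by
      rw [← mul_sub, h3]
    linarith
  have h1 := key a b
  have h2 := key b a
  rw [norm_sub_rev] at h2
  have h3 : ⟪a - b, gradient f a - gradient f b⟫_ℝ
      = -⟪gradient f a, b - a⟫_ℝ - ⟪gradient f b, a - b⟫_ℝ := by
    rw [real_inner_comm, inner_sub_left, ← neg_sub a b, inner_neg_right]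
    ring
  rw [← inv_mul_le_iff₀ hL, h3]
  linarith

end SmoothConvex

section SecondOrder

variable {E : Type*} [NormedAddCommGroup E] [InnerProductSpace ℝ E]

theorem antitoneOn_Icc_of_hasDerivAt_nonpos {φ φ' : ℝ → ℝ} {a b : ℝ}
    (hφ : ∀ s ∈ Set.Icc a b, HasDerivAt φ (φ' s) s) (hφ' : ∀ s ∈ Set.Icc a b, φ' s ≤ 0) :
    AntitoneOn φ (Set.Icc a b) :=
  antitoneOn_of_hasDerivWithinAt_nonpos (convex_Icc a b)
    (fun s hs => (hφ s hs).continuousAt.continuousWithinAt)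
    (fun s hs => (hφ s (interior_subset hs)).hasDerivWithinAt)
    (fun s hs => hφ' s (interior_subset hs))

theorem exists_forall_nonneg_hasDerivAt {ρ : ℝ → ℝ} (hρ : ContinuousOn ρ (Set.Ici 0))
    (hρ0 : ∀ s, 0 ≤ s → 0 ≤ ρ s) :
    ∃ P P' : ℝ → ℝ, P 0 = 0 ∧ (∀ s, 0 ≤ s → P' s = ρ s) ∧ (∀ s, 0 ≤ s → 0 ≤ P s) ∧
      ∀ s, HasDerivAt P (P' s) s := by
  have hc : Continuous fun s => ρ (max s 0) :=
    hρ.comp_continuous (by fun_prop) fun s => le_max_right s 0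
  refine ⟨fun s => ∫ r in (0 : ℝ)..s, ρ (max r 0), _, by simp, fun s hs => ?_, fun s hs => ?_,
    fun s => hc.integral_hasStrictDerivAt 0 s |>.hasDerivAt⟩
  · simp [hs]
  · exact intervalIntegral.integral_nonneg hs fun r _ => hρ0 _ (le_max_right r 0)

/-- If `w' = -g` with `w 0 = 0` and `‖g‖² ≤ L ρ`, then `‖w t‖² ≤ L t ∫₀ᵗ ρ`. -/
theorem norm_sq_le_mul_of_hasDerivAt {w g : ℝ → E} {P ρ : ℝ → ℝ} {L : ℝ}
    (hw : ∀ t, 0 ≤ t → HasDerivAt w (-g t) t) (hw0 : w 0 = 0)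
    (hP : ∀ t, 0 ≤ t → HasDerivAt P (ρ t) t) (hP0 : P 0 = 0)
    (hg : ∀ t, 0 ≤ t → ‖g t‖ ^ 2 ≤ L * ρ t) {t : ℝ} (ht : 0 ≤ t) :
    ‖w t‖ ^ 2 ≤ L * t * P t := by
  rcases ht.eq_or_lt with rfl | ht'
  · simp [hw0]
  have key (z : E) : 2 * ⟪z, w t⟫_ℝ ≤ t * ‖z‖ ^ 2 + L * P t := by
    have hd (s : ℝ) (hs : s ∈ Set.Icc 0 t) :
        HasDerivAt (fun s => 2 * ⟪z, w s⟫_ℝ - s * ‖z‖ ^ 2 - L * P s)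
          (-(2 * ⟪z, g s⟫_ℝ) - ‖z‖ ^ 2 - L * ρ s) s := by
      have h1 := ((hasDerivAt_const s z).inner ℝ (hw s hs.1)).const_mul 2
      have h2 := (hasDerivAt_id s).mul_const (‖z‖ ^ 2)
      refine ((h1.sub h2).sub ((hP s hs.1).const_mul L)).congr_deriv ?_
      simp
    have := antitoneOn_Icc_of_hasDerivAt_nonpos hd (fun s hs => by
      have h1 := hg s hs.1
      have h2 := norm_add_sq_real z (g s)
      nlinarith [sq_nonneg ‖z + g s‖]) (Set.left_mem_Icc.2 ht) (Set.right_mem_Icc.2 ht) ht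
    simp [hw0, hP0] at this
    linarith
  have h := key (t⁻¹ • w t)
  rw [inner_smul_left, real_inner_self_eq_norm_sq, norm_smul,
    Real.norm_of_nonneg (by positivity)] at h
  simp only [conj_trivial] at h
  have h1 : t * (t⁻¹ * ‖w t‖) ^ 2 = t⁻¹ * ‖w t‖ ^ 2 := by field_simp
  have h2 : t⁻¹ * ‖w t‖ ^ 2 ≤ L * P t := by linarith
  rw [inv_mul_le_iff₀ ht'] at h2
  linarith

/-- Contraction estimate for `e'' = -g` started at rest, where the force `g` is strongly monotone
and cocoercive along the trajectory `e`. -/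
theorem inner_deriv_le_of_cocoercive {e w g : ℝ → E} {μ L : ℝ} (hμ : 0 < μ) (hL : 0 < L)
    (he : ∀ t, 0 ≤ t → HasDerivAt e (w t) t) (hw : ∀ t, 0 ≤ t → HasDerivAt w (-g t) t)
    (hw0 : w 0 = 0) (hgc : ContinuousOn g (Set.Ici 0))
    (hmono : ∀ t, 0 ≤ t → μ * ‖e t‖ ^ 2 ≤ ⟪e t, g t⟫_ℝ)
    (hcoc : ∀ t, 0 ≤ t → ‖g t‖ ^ 2 ≤ L * ⟪e t, g t⟫_ℝ)
    {t : ℝ} (ht : 0 ≤ t) (htL : L * t ^ 2 ≤ 1 / 4) :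
    ⟪e t, w t⟫_ℝ ≤ -(1 / 2 * ‖e 0‖ ^ 2) * (μ / 2) * t := by
  have hec : ContinuousOn e (Set.Ici 0) := fun s hs => (he s hs).continuousAt.continuousWithinAt
  have hρ0 (s : ℝ) (hs : 0 ≤ s) : 0 ≤ ⟪e s, g s⟫_ℝ := le_trans (by positivity) (hmono s hs)
  obtain ⟨P, P', hP0, hPρ, hPn, hP⟩ :=
    exists_forall_nonneg_hasDerivAt (hec.inner hgc) hρ0
  replace hP (s : ℝ) (hs : 0 ≤ s) : HasDerivAt P ⟪e s, g s⟫_ℝ s := hPρ s hs ▸ hP s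
  have hinner (s : ℝ) (hs : 0 ≤ s) : ⟪e s, w s⟫_ℝ ≤ -P s * (1 - L * s ^ 2 / 2) := by
    have hd (r : ℝ) (hr : r ∈ Set.Icc 0 s) :
        HasDerivAt (fun r => ⟪e r, w r⟫_ℝ + P r * (1 - L / 2 * r ^ 2))
          (‖w r‖ ^ 2 - L * r * P r - ⟪e r, g r⟫_ℝ * (L / 2 * r ^ 2)) r := by
      have h1 := ((hasDerivAt_id r).pow 2).const_mul (L / 2) |>.const_sub 1
      refine (((he r hr.1).inner ℝ (hw r hr.1)).add ((hP r hr.1).mul h1)).congr_deriv ?_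
      simp
      ring
    have := antitoneOn_Icc_of_hasDerivAt_nonpos hd (fun r hr => by
      have h1 := norm_sq_le_mul_of_hasDerivAt hw hw0 hP hP0 hcoc hr.1
      have h2 := hρ0 r hr.1
      have : 0 ≤ ⟪e r, g r⟫_ℝ * (L / 2 * r ^ 2) := by positivity
      linarith) (Set.left_mem_Icc.2 hs) (Set.right_mem_Icc.2 hs) hs
    simp [hw0, hP0] at this
    linarith
  have hLs {s : ℝ} (hs : s ∈ Set.Icc 0 t) : L * s ^ 2 ≤ 1 / 4 :=
    le_trans (by gcongr; exacts [hs.1, hs.2]) htL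
  have hle (s : ℝ) (hs : s ∈ Set.Icc 0 t) : ‖e s‖ ≤ ‖e 0‖ := by
    have := antitoneOn_Icc_of_hasDerivAt_nonpos (fun r hr => (he r hr.1).norm_sq) (fun r hr => by
      have := hinner r hr.1
      nlinarith [hPn r hr.1, hLs hr]) (Set.left_mem_Icc.2 ht) hs hs.1
    exact (sq_le_sq₀ (norm_nonneg _) (norm_nonneg _)).1 this
  have hg (s : ℝ) (hs : s ∈ Set.Icc 0 t) : ‖g s‖ ≤ L * ‖e 0‖ := by
    have h1 := hcoc s hs.1
    have h2 := real_inner_le_norm (e s) (g s)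
    refine le_trans ?_ (mul_le_mul_of_nonneg_left (hle s hs) hL.le)
    by_contra! hlt
    have h3 : 0 < ‖g s‖ := lt_of_le_of_lt (by positivity) hlt
    nlinarith [mul_lt_mul_of_pos_right hlt h3, mul_le_mul_of_nonneg_left h2 hL.le]
  have hwb (s : ℝ) (hs : s ∈ Set.Icc 0 t) : ‖w s‖ ≤ L * ‖e 0‖ * t := by
    have := (convex_Icc 0 t).norm_image_sub_le_of_norm_hasDerivWithin_le
      (fun r hr => (hw r hr.1).hasDerivWithinAt)
      (fun r hr => (norm_neg (g r)).trans_le (hg r hr)) (Set.left_mem_Icc.2 ht) hs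
    rw [hw0, sub_zero, sub_zero, Real.norm_of_nonneg hs.1] at this
    exact this.trans (by gcongr; exact hs.2)
  have hlow (s : ℝ) (hs : s ∈ Set.Icc 0 t) : 3 / 4 * ‖e 0‖ ≤ ‖e s‖ := by
    have h1 := (convex_Icc 0 t).norm_image_sub_le_of_norm_hasDerivWithin_le
      (fun r hr => (he r hr.1).hasDerivWithinAt) hwb (Set.left_mem_Icc.2 ht) hs
    rw [sub_zero, Real.norm_of_nonneg hs.1] at h1
    have h2 : L * ‖e 0‖ * t * s ≤ L * ‖e 0‖ * t * t := by gcongr; exact hs.2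
    have h3 := norm_sub_norm_le (e 0) (e s)
    rw [norm_sub_rev] at h3
    nlinarith [mul_le_mul_of_nonneg_right htL (norm_nonneg (e 0))]
  have hPlow : μ * (9 / 16 * ‖e 0‖ ^ 2) * t ≤ P t := by
    have := antitoneOn_Icc_of_hasDerivAt_nonpos
      (fun s hs => ((hasDerivAt_id s).const_mul (μ * (9 / 16 * ‖e 0‖ ^ 2))).sub (hP s hs.1))
      (fun s hs => by
        have h1 : (3 / 4 * ‖e 0‖) ^ 2 ≤ ‖e s‖ ^ 2 := by gcongr; exact hlow s hs
        have h2 : μ * (9 / 16 * ‖e 0‖ ^ 2) ≤ μ * ‖e s‖ ^ 2 := by gcongr; linarith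
        linarith [hmono s hs.1])
      (Set.left_mem_Icc.2 ht) (Set.right_mem_Icc.2 ht) ht
    simp [hP0] at this
    linarith
  have h1 : 0 ≤ μ * ‖e 0‖ ^ 2 * t := by positivity
  nlinarith [hinner t ht, mul_le_mul_of_nonneg_left htL (hPn t ht)]

end SecondOrder

/-- If `f` is `μ`-strongly convex and `L`-smooth and `x, y` solve the Hamiltonian ODE
`x'' = -∇f(x)` with equal initial velocities, then `α(t) = (1/2)‖x(t) - y(t)‖²` satisfies
`α'(t) ≤ -α(0)·(μ/2)·t` for all `0 ≤ t ≤ 1/(2√L)`. -/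
theorem hmc_alpha_deriv_bound {d : ℕ} (μ L : ℝ) (hμ : 0 < μ) (hμL : μ ≤ L)
    (f : EuclideanSpace ℝ (Fin d) → ℝ) (hf : ContDiff ℝ 1 f)
    (hstrong : ∀ a b : EuclideanSpace ℝ (Fin d),
      f b ≥ f a + ⟪gradient f a, b - a⟫_ℝ + μ / 2 * ‖b - a‖ ^ 2)
    (hsmooth : ∀ a b : EuclideanSpace ℝ (Fin d),
      ‖gradient f a - gradient f b‖ ≤ L * ‖a - b‖)
    (x y u v : ℝ → EuclideanSpace ℝ (Fin d))
    (hx : ∀ t, 0 ≤ t → HasDerivAt x (u t) t)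
    (hu : ∀ t, 0 ≤ t → HasDerivAt u (-gradient f (x t)) t)
    (hy : ∀ t, 0 ≤ t → HasDerivAt y (v t) t)
    (hv : ∀ t, 0 ≤ t → HasDerivAt v (-gradient f (y t)) t)
    (h0 : u 0 = v 0) :
    ∀ t, 0 ≤ t → t ≤ 1 / (2 * Real.sqrt L) →
      deriv (fun s => 1 / 2 * ‖x s - y s‖ ^ 2) t ≤
        -(1 / 2 * ‖x 0 - y 0‖ ^ 2) * (μ / 2) * t := by
  intro t ht htL
  have hL : 0 < L := hμ.trans_le hμL
  have hdiff : Differentiable ℝ f := hf.differentiable one_ne_zero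
  have he (s : ℝ) (hs : 0 ≤ s) : HasDerivAt (fun s => x s - y s) (u s - v s) s :=
    (hx s hs).sub (hy s hs)
  have hα := (he t ht).norm_sq.const_mul (1 / 2)
  rw [hα.deriv, one_div, inv_mul_cancel_left₀ two_ne_zero, ← one_div]
  have hgrad : Continuous (gradient f) :=
    (LipschitzWith.of_dist_le_mul (K := L.toNNReal) fun a b => by
      simpa [dist_eq_norm, hL.le] using hsmooth a b).continuous
  have hcont {z z' : ℝ → EuclideanSpace ℝ (Fin d)} (hz : ∀ t, 0 ≤ t → HasDerivAt z (z' t) t) :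
      ContinuousOn (fun s => gradient f (z s)) (Set.Ici 0) :=
    hgrad.comp_continuousOn fun s hs => (hz s hs).continuousAt.continuousWithinAt
  refine inner_deriv_le_of_cocoercive (e := fun s => x s - y s) (w := fun s => u s - v s)
    (g := fun s => gradient f (x s) - gradient f (y s)) hμ hL he
    (fun s hs => ((hu s hs).sub (hv s hs)).congr_deriv (by abel)) (sub_eq_zero.2 h0)
    ((hcont hx).sub (hcont hy)) (fun s _ => ?_) (fun s _ => ?_) ht ?_
  · have h1 := hstrong (x s) (y s)
    have h2 := hstrong (y s) (x s)
    rw [← neg_sub (x s) (y s), inner_neg_right, norm_neg] at h1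
    rw [real_inner_comm, inner_sub_left]
    linarith
  · refine norm_gradient_sub_sq_le_inner hL hdiff (fun a b => ?_) hsmooth _ _
    have : 0 ≤ μ / 2 * ‖b - a‖ ^ 2 := by positivity
    linarith [hstrong a b]
  · have h1 : t ^ 2 ≤ (1 / (2 * √L)) ^ 2 := by gcongr
    rw [div_pow, mul_pow, Real.sq_sqrt hL.le] at h1
    calc L * t ^ 2 ≤ L * (1 ^ 2 / (2 ^ 2 * L)) := by gcongr
      _ = 1 / 4 := by field_simp; norm_num
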